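/- arXiv:2505.20974 — 4 statements merged into one kernel-verified Lean document; each statement's English description precedes it below -/
import Mathlib

section
/- Let A be a commutative unital ℂ-algebra, let n ≥ 1, and let a ∈ A satisfy a^n = 0. Then for any ℂ-linear derivations ∂₁, …, ∂_{2n−1} of A one has (∂₁ a)·(∂₂ a)⋯(∂_{2n−1} a) = 0. -/
theorem Derivation.apply_finset_prod {R A ι : Type*} [CommRing R] [CommRing A] [Algebra R A]
    [DecidableEq ι] (D : Derivation R A A) (s : Finset ι) (f : ι → A) :
    D (∏ i ∈ s, f i) = ∑ i ∈ s, (∏ j ∈ s.erase i, f j) * D (f i) := by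
  induction s using Finset.induction_on with
  | empty => simp
  | insert x s hx ih =>
    rw [Finset.prod_insert hx, Finset.sum_insert hx, Derivation.leibniz, ih,
      Finset.erase_insert hx, smul_eq_mul, smul_eq_mul, Finset.mul_sum, add_comm]
    congr 1
    refine Finset.sum_congr rfl fun i hi => ?_
    have hxi : x ≠ i := fun h => hx (h ▸ hi)
    rw [Finset.erase_insert_of_ne hxi, Finset.prod_insert (fun h => hx (Finset.mem_of_mem_erase h)),
      mul_assoc]

/-- If `a ^ (m + k + 1) = 0`, then `a ^ m` kills every product of `2 * k + 1` derivatives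
of `a`. -/
theorem Derivation.pow_mul_prod_apply_eq_zero {K A ι : Type*} [Field K] [CharZero K] [CommRing A]
    [Algebra K A] [DecidableEq ι] (D : ι → Derivation K A A) (a : A) (k : ℕ) :
    ∀ (m : ℕ) (s : Finset ι), a ^ (m + k + 1) = 0 → s.card = 2 * k + 1 →
      a ^ m * ∏ i ∈ s, D i a = 0 := by
  have cancel : ∀ (m : ℕ) (x : A), ((m + 1 : ℕ) : A) * x = 0 → x = 0 := by
    intro m x hx
    have h : ((m + 1 : ℕ) : K) • x = 0 := by
      rwa [Nat.cast_smul_eq_nsmul, nsmul_eq_mul]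
    exact (smul_eq_zero_iff_right (Nat.cast_ne_zero.mpr m.succ_ne_zero)).mp h
  induction k with
  | zero =>
    intro m s ha hs
    obtain ⟨i, rfl⟩ := Finset.card_eq_one.mp hs
    have h := congrArg (D i) ha
    rw [Derivation.leibniz_pow, map_zero, nsmul_eq_mul, smul_eq_mul] at h
    simpa using cancel m _ h
  | succ k ih =>
    intro m s ha hs
    obtain ⟨i, u, hi, rfl, hu⟩ := Finset.card_eq_succ.mp hs
    obtain ⟨j, t, hj, rfl, ht⟩ := Finset.card_eq_succ.mp (hu.trans (by omega : _ = 2 * k + 1 + 1))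
    have ha' : a ^ (m + 1 + k + 1) = 0 := by
      rw [← ha]; congr 1; omega
    have h := congrArg (D i) (ih (m + 1) t ha' ht)
    rw [Derivation.leibniz, Derivation.leibniz_pow, map_zero, Derivation.apply_finset_prod,
      nsmul_eq_mul] at h
    simp only [smul_eq_mul, Nat.add_sub_cancel] at h
    have hsum : D j a * (a ^ (m + 1) *
        ∑ l ∈ t, (∏ p ∈ t.erase l, D p a) * D i (D l a)) = 0 := by
      rw [Finset.mul_sum, Finset.mul_sum]
      refine Finset.sum_eq_zero fun l hl => ?_
      have hjl : j ∉ t.erase l := fun h => hj (Finset.mem_of_mem_erase h)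
      have h0 := ih (m + 1) (insert j (t.erase l)) ha' (by
        rw [Finset.card_insert_of_notMem hjl, Finset.card_erase_of_mem hl, ht]; omega)
      rw [Finset.prod_insert hjl] at h0
      linear_combination D i (D l a) * h0
    rw [Finset.prod_insert hi, Finset.prod_insert hj]
    apply cancel m
    linear_combination D j a * h - hsum

/-- Let `A` be a commutative unital `ℂ`-algebra, `n ≥ 1`, and `a ∈ A` with
`a ^ n = 0`.  Then for any `ℂ`-linear derivations `∂₁, …, ∂_{2n−1}` of `A` we have
`(∂₁ a) ⋯ (∂_{2n−1} a) = 0`. -/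
theorem stmt_0 (A : Type*) [CommRing A] [Algebra ℂ A] (n : ℕ) (hn : 1 ≤ n)
    (a : A) (ha : a ^ n = 0) (D : Fin (2 * n - 1) → Derivation ℂ A A) :
    (∏ i, D i a) = 0 := by
  obtain ⟨k, rfl⟩ := Nat.exists_eq_add_of_le' hn
  simpa using Derivation.pow_mul_prod_apply_eq_zero D a k 0 Finset.univ (by simpa using ha)
    (by rw [Finset.card_univ, Fintype.card_fin]; omega)
end

section
/- Let R be an associative unital ℂ-algebra, let n ≥ 1, and let a, b ∈ R satisfy a^n = 0 and [a,[a,b]] = 0. Then [a,b]^{2n−1} = 0. -/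
open LinearMap in
/-- If `a ^ n = 0`, then the inner derivation `y ↦ a * y - y * a` is nilpotent of
index at most `2 * n - 1`. -/
theorem mulLeft_sub_mulRight_pow_eq_zero {R : Type*} [Ring R] {n : ℕ} (hn : 1 ≤ n) {a : R}
    (ha : a ^ n = 0) : (mulLeft ℤ a - mulRight ℤ a) ^ (2 * n - 1) = 0 := by
  rw [sub_eq_add_neg]
  have hcomm : Commute (mulLeft ℤ a) (-mulRight ℤ a) := (commute_mulLeft_right a a).neg_right
  refine hcomm.add_pow_eq_zero_of_add_le_succ_of_pow_eq_zero (m := n) (n := n) ?_ ?_ (by omega)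
  · rw [pow_mulLeft, ha, mulLeft_zero_eq_zero]
  · rw [neg_pow, pow_mulRight, ha, mulRight_zero_eq_zero, mul_zero]

open LinearMap in
/-- Leibniz rule for the iterates of an inner derivation on `x * b`, when the second
derivative of `b` vanishes. -/
theorem mulLeft_sub_mulRight_pow_succ_apply_mul {R : Type*} [Ring R] {a b : R}
    (hab : Commute a (a * b - b * a)) (x : R) (k : ℕ) :
    ((mulLeft ℤ a - mulRight ℤ a) ^ (k + 1)) (x * b) =
      ((mulLeft ℤ a - mulRight ℤ a) ^ (k + 1)) x * b +
        (k + 1) • (((mulLeft ℤ a - mulRight ℤ a) ^ k) x * (a * b - b * a)) := by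
  induction k with
  | zero => simp; noncomm_ring
  | succ k ih =>
    set D := mulLeft ℤ a - mulRight ℤ a with hD
    have hDmul (y z : R) : D (y * z) = D y * z + y * D z := by
      simp only [hD, LinearMap.sub_apply, mulLeft_apply, mulRight_apply]
      noncomm_ring
    have hDb : D b = a * b - b * a := rfl
    have hDc : D (a * b - b * a) = 0 := sub_eq_zero.mpr hab.eq
    rw [pow_succ' D (k + 1), Module.End.mul_apply, ih, map_add, map_nsmul, hDmul, hDmul, hDb,
      hDc, mul_zero, add_zero, ← Module.End.mul_apply, ← Module.End.mul_apply,
      ← pow_succ', ← pow_succ', add_assoc, succ_nsmul' _ (k + 1)]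

open LinearMap in
/-- If `a` commutes with `[a, b]`, then the `m`-th derivative of `b ^ m` is `m! * [a, b] ^ m`. -/
theorem mulLeft_sub_mulRight_pow_apply_pow {R : Type*} [Ring R] {a b : R}
    (hab : Commute a (a * b - b * a)) (m : ℕ) :
    ((mulLeft ℤ a - mulRight ℤ a) ^ m) (b ^ m) = m.factorial • (a * b - b * a) ^ m := by
  induction m with
  | zero => simp
  | succ m ih =>
    have hz : ((mulLeft ℤ a - mulRight ℤ a) ^ (m + 1)) (b ^ m) = 0 := by
      rw [pow_succ', Module.End.mul_apply, ih, map_nsmul]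
      simp [(hab.pow_right m).eq]
    rw [pow_succ b, mulLeft_sub_mulRight_pow_succ_apply_mul hab, hz, ih, zero_mul, zero_add,
      smul_mul_assoc, ← pow_succ, smul_smul, Nat.factorial_succ]

/-- Let `R` be an associative unital `ℂ`-algebra, `n ≥ 1`, and `a, b ∈ R` with
`a ^ n = 0` and `[a, [a, b]] = 0`, where `[x, y] = x * y - y * x` is the commutator.
Then `[a, b] ^ (2n − 1) = 0`. -/
theorem stmt_1 (R : Type*) [Ring R] [Algebra ℂ R] (n : ℕ) (hn : 1 ≤ n)
    (a b : R) (ha : a ^ n = 0)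
    (hab : a * (a * b - b * a) - (a * b - b * a) * a = 0) :
    (a * b - b * a) ^ (2 * n - 1) = 0 := by
  have h := mulLeft_sub_mulRight_pow_apply_pow (sub_eq_zero.mp hab) (2 * n - 1)
  rw [mulLeft_sub_mulRight_pow_eq_zero hn ha, LinearMap.zero_apply, ← Nat.cast_smul_eq_nsmul ℂ]
    at h
  exact (smul_eq_zero_iff_right (Nat.cast_ne_zero.mpr (Nat.factorial_ne_zero _))).mp h.symm
end

section
/- Let L be a Lie algebra over a field k, let A be a Lie subalgebra of L, and let B be a linear subspace of L such that L = A + B (as subspaces) and ⁅A, B⁆ ⊆ B. Then the subspace B + ⁅B, B⁆ is a Lie ideal of L. -/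
/-- Let `L` be a Lie algebra over a field `k`, `A` a Lie subalgebra of `L`, and
`B` a linear subspace of `L` with `L = A + B` and `⁅A, B⁆ ⊆ B`.  Then `B + ⁅B, B⁆` is a Lie ideal
of `L`. -/
theorem stmt_4 (k : Type*) [Field k] (L : Type*) [LieRing L] [LieAlgebra k L]
    (A : LieSubalgebra k L) (B : Submodule k L)
    (hsum : A.toSubmodule ⊔ B = ⊤)
    (hAB : ∀ a ∈ A, ∀ b ∈ B, ⁅a, b⁆ ∈ B) :
    ∃ I : LieIdeal k L,
      (I : Submodule k L) =
        B ⊔ Submodule.span k {z : L | ∃ x ∈ B, ∃ y ∈ B, z = ⁅x, y⁆} := by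
  set S : Submodule k L :=
    B ⊔ Submodule.span k {z : L | ∃ x ∈ B, ∃ y ∈ B, z = ⁅x, y⁆}
  have hBS : ∀ b ∈ B, b ∈ S := fun b hb => Submodule.mem_sup_left hb
  have hBB : ∀ x ∈ B, ∀ y ∈ B, ⁅x, y⁆ ∈ S := fun x hx y hy =>
    Submodule.mem_sup_right (Submodule.subset_span ⟨x, hx, y, hy, rfl⟩)
  have hdecomp : ∀ z : L, ∃ a ∈ A, ∃ b ∈ B, a + b = z := fun z =>
    Submodule.mem_sup.mp (hsum ▸ Submodule.mem_top : z ∈ A.toSubmodule ⊔ B)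
  have hBL : ∀ b ∈ B, ∀ z : L, ⁅b, z⁆ ∈ S := by
    intro b hb z
    obtain ⟨a, ha, b', hb', rfl⟩ := hdecomp z
    rw [lie_add, ← lie_skew b a]
    exact S.add_mem (S.neg_mem (hBS _ (hAB a ha b hb))) (hBB b hb b' hb')
  have hgen : ∀ w x y : L, x ∈ B → y ∈ B → ⁅w, ⁅x, y⁆⁆ ∈ S := by
    intro w x y hx hy
    obtain ⟨a, ha, b, hb, rfl⟩ := hdecomp w
    rw [add_lie, leibniz_lie a]
    exact S.add_mem
      (S.add_mem (hBB _ (hAB a ha x hx) y hy) (hBB x hx _ (hAB a ha y hy)))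
      (hBL b hb _)
  have hle : ∀ w : L, S ≤ S.comap (LieAlgebra.ad k L w : L →ₗ[k] L) := by
    intro w
    refine sup_le (fun b hb => ?_) (Submodule.span_le.mpr ?_)
    · rw [Submodule.mem_comap, LieAlgebra.ad_apply, ← lie_skew]
      exact S.neg_mem (hBL b hb w)
    · rintro _ ⟨x, hx, y, hy, rfl⟩
      exact hgen w x y hx hy
  exact ⟨{ S with lie_mem := fun {w _} hm => hle w hm }, rfl⟩
end

section
/- Let R be a commutative unital ℂ-algebra with a ℂ-linear derivation ∂, let d ≥ 0 be an integer, and let r, s ∈ R and nonzero scalars α, β ∈ ℂ satisfy ∂^d(r) = α·1 and ∂^d(s) = β·1. Suppose f(r, s) = 0 for some nonzero homogeneous polynomial f ∈ ℂ[x, y]. Then the element α⁻¹·r − β⁻¹·s is nilpotent in R. -/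
/-- An element of a minimal prime ideal becomes nilpotent after localizing at that prime. -/
theorem Ideal.exists_mul_pow_eq_zero_of_mem_minimalPrimes {R : Type*} [CommRing R] {P : Ideal R}
    (hP : P ∈ minimalPrimes R) {x : R} (hx : x ∈ P) : ∃ y ∉ P, ∃ n : ℕ, y * x ^ n = 0 := by
  have hprime : P.IsPrime := hP.1.1
  by_contra! hne
  obtain ⟨Q, hQ, -, hdisj⟩ := Ideal.exists_le_prime_disjoint (⊥ : Ideal R)
    (P.primeCompl ⊔ Submonoid.powers x) <| by
      rw [Set.disjoint_left]
      rintro z hz hz'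
      obtain ⟨y, hy, w, ⟨n, rfl⟩, rfl⟩ := Submonoid.mem_sup.1 hz'
      exact hne y hy n hz
  rw [Set.disjoint_left] at hdisj
  have hQP : Q ≤ P := fun z hz => by
    by_contra hzP
    exact hdisj hz ((le_sup_left : P.primeCompl ≤ _) hzP)
  exact hdisj (hP.2 ⟨hQ, bot_le⟩ hQP hx)
    ((le_sup_right : Submonoid.powers x ≤ _) (Submonoid.mem_powers x))

/-- In characteristic zero, a derivation maps every minimal prime ideal into itself. -/
theorem Derivation.apply_mem_of_mem_minimalPrimes {k R : Type*} [Field k] [CharZero k]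
    [CommRing R] [Algebra k R] (D : Derivation k R R) {P : Ideal R} (hP : P ∈ minimalPrimes R)
    {x : R} (hx : x ∈ P) : D x ∈ P := by
  have hprime : P.IsPrime := hP.1.1
  obtain ⟨y, hy, n, hn⟩ := Ideal.exists_mul_pow_eq_zero_of_mem_minimalPrimes hP hx
  have key : ∀ l a b : ℕ, y ^ a * x ^ l * D x ^ b = 0 → ∃ a b : ℕ, y ^ a * D x ^ b = 0 := by
    intro l
    induction l with
    | zero => exact fun a b h => ⟨a, b, by simpa using h⟩
    | succ l ih =>
      intro a b h
      apply ih (a + 1) (b + 2)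
      have h1 : y ^ (a + 1) * x ^ (l + 1) * D x ^ (b + 1) = 0 := by
        linear_combination (y * D x) * h
      have h2 := congrArg D h1
      simp only [Derivation.leibniz, Derivation.leibniz_pow, smul_eq_mul, nsmul_eq_mul,
        Nat.add_sub_cancel, map_zero] at h2
      have h3 : ((l + 1 : ℕ) : R) * (y ^ (a + 1) * x ^ l * D x ^ (b + 2)) = 0 := by
        linear_combination h2 -
          (((a + 1 : ℕ) : R) * D y * D x + ((b + 1 : ℕ) : R) * y * D (D x)) * h
      have hunit : IsUnit ((l + 1 : ℕ) : R) := by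
        rw [← _root_.map_natCast (algebraMap k R)]
        exact (IsUnit.mk0 _ (Nat.cast_ne_zero.2 l.succ_ne_zero)).map _
      exact hunit.mul_right_eq_zero.1 h3
  obtain ⟨a, b, h⟩ := key n 1 0 (by simpa using hn)
  have hmem : y ^ a * D x ^ b ∈ P := h ▸ P.zero_mem
  rcases hprime.mem_or_mem hmem with h | h
  · exact absurd (hprime.mem_of_pow_mem _ h) hy
  · exact hprime.mem_of_pow_mem _ h

/-- Scaling the arguments of a homogeneous polynomial of degree `m` by `t` scales its value
by `t ^ m`. -/
theorem MvPolynomial.IsHomogeneous.aeval_mul {σ k A : Type*} [CommSemiring k] [CommSemiring A]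
    [Algebra k A] {f : MvPolynomial σ k} {m : ℕ} (hf : f.IsHomogeneous m) (t : A) (x : σ → A) :
    MvPolynomial.aeval (fun i => t * x i) f = t ^ m * MvPolynomial.aeval x f := by
  simp only [MvPolynomial.aeval_def, MvPolynomial.eval₂_eq, Finset.mul_sum]
  refine Finset.sum_congr rfl fun d hd => ?_
  have hdeg : ∑ i ∈ d.support, d i = m := by
    simpa [Finsupp.weight_apply, Finsupp.sum] using hf (MvPolynomial.mem_support_iff.1 hd)
  rw [← hdeg, ← Finset.prod_pow_eq_pow_sum]
  simp only [mul_pow, Finset.prod_mul_distrib]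
  ring

/-- A binary form is recovered from its dehomogenization in one variable. -/
theorem MvPolynomial.IsHomogeneous.aeval_eq_pow_mul_aeval_div {k K : Type*} [CommSemiring k]
    [Field K] [Algebra k K] {f : MvPolynomial (Fin 2) k} {m : ℕ} (hf : f.IsHomogeneous m)
    (u : K) {v : K} (hv : v ≠ 0) :
    MvPolynomial.aeval ![u, v] f = v ^ m *
      Polynomial.aeval (u / v)
        (MvPolynomial.aeval ![Polynomial.X, 1] f : Polynomial k) := by
  have h1 := hf.aeval_mul v ![u / v, 1]
  have h2 := DFunLike.congr_fun (MvPolynomial.comp_aeval (![Polynomial.X, 1] : Fin 2 → Polynomial k)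
    (Polynomial.aeval (R := k) (u / v))) f
  rw [AlgHom.comp_apply] at h2
  rw [h2]
  convert h1 using 3
  · ext i
    fin_cases i <;> simp [mul_div_cancel₀, hv]
  · congr 1
    ext i
    fin_cases i <;> simp

/-- Over an algebraically closed field, the zeros of a nonzero binary form in an extension field
are proportional to rational points. -/
theorem MvPolynomial.IsHomogeneous.exists_eq_algebraMap_mul_of_aeval_eq_zero {k K : Type*}
    [Field k] [IsAlgClosed k] [Field K] [Algebra k K] {f : MvPolynomial (Fin 2) k} {m : ℕ}
    (hf : f.IsHomogeneous m) (hf0 : f ≠ 0) {u v : K} (hv : v ≠ 0)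
    (h : MvPolynomial.aeval ![u, v] f = 0) : ∃ c : k, u = algebraMap k K c * v := by
  have hp0 : (MvPolynomial.aeval ![Polynomial.X, 1] f : Polynomial k) ≠ 0 := by
    intro hp
    have : Infinite k := IsAlgClosed.instInfinite
    have hfX : f * MvPolynomial.X 1 = 0 := MvPolynomial.funext fun x => by
      rcases eq_or_ne (x 1) 0 with hx | hx
      · simp [hx]
      · have hx' := hf.aeval_eq_pow_mul_aeval_div (x 0) hx
        have hvec : ![x 0, x 1] = x := by ext i; fin_cases i <;> rfl
        rw [hp, map_zero, mul_zero, hvec, MvPolynomial.aeval_eq_eval] at hx'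
        simpa using Or.inl hx'
    exact (mul_ne_zero hf0 (MvPolynomial.X_ne_zero 1)) hfX
  rw [hf.aeval_eq_pow_mul_aeval_div u hv] at h
  have hint : IsIntegral k (u / v) :=
    IsAlgebraic.isIntegral ⟨_, hp0, (mul_eq_zero.1 h).resolve_left (pow_ne_zero _ hv)⟩
  obtain ⟨c, hc⟩ := minpoly.mem_range_of_degree_eq_one k (u / v)
    (IsAlgClosed.degree_eq_one_of_irreducible k (minpoly.irreducible hint))
  exact ⟨c, by rw [hc, div_mul_cancel₀ _ hv]⟩

/-- Let `R` be a commutative unital `ℂ`-algebra with a `ℂ`-linear derivation `D`,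
let `d ≥ 0`, and let `r, s ∈ R` and nonzero `α, β ∈ ℂ` satisfy `D^d r = α·1`, `D^d s = β·1`.
If `f(r, s) = 0` for some nonzero homogeneous polynomial `f ∈ ℂ[x, y]`, then `α⁻¹·r − β⁻¹·s` is
nilpotent in `R`. -/
theorem stmt_5 (R : Type*) [CommRing R] [Algebra ℂ R] (D : Derivation ℂ R R)
    (d : ℕ) (r s : R) (α β : ℂ) (hα : α ≠ 0) (hβ : β ≠ 0)
    (hr : (D.toLinearMap ^ d) r = algebraMap ℂ R α)
    (hs : (D.toLinearMap ^ d) s = algebraMap ℂ R β)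
    (f : MvPolynomial (Fin 2) ℂ) (hf0 : f ≠ 0) (m : ℕ)
    (hfhom : f.IsHomogeneous m)
    (hfrs : MvPolynomial.aeval ![r, s] f = 0) :
    IsNilpotent (α⁻¹ • r - β⁻¹ • s) := by
  rw [← mem_nilradical, nilradical, ← Ideal.sInf_minimalPrimes, Ideal.mem_sInf]
  intro P hP
  have hprime : P.IsPrime := hP.1.1
  have hD : ∀ n : ℕ, ∀ x ∈ P, (D.toLinearMap ^ n) x ∈ P := by
    intro n
    induction n with
    | zero => exact fun x hx => hx
    | succ n ih =>
      intro x hx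
      rw [pow_succ, Module.End.mul_apply]
      exact ih _ (D.apply_mem_of_mem_minimalPrimes hP hx)
  have hscalar : ∀ c : ℂ, algebraMap ℂ R c ∈ P → c = 0 := fun c hc => by
    by_contra hc0
    exact hprime.ne_top (P.eq_top_of_isUnit_mem hc ((IsUnit.mk0 c hc0).map _))
  let φ : R →ₐ[ℂ] FractionRing (R ⧸ P) :=
    (IsScalarTower.toAlgHom ℂ (R ⧸ P) (FractionRing (R ⧸ P))).comp (Ideal.Quotient.mkₐ ℂ P)
  have hφ : ∀ x, φ x = 0 ↔ x ∈ P := fun x => by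
    rw [← Ideal.Quotient.eq_zero_iff_mem]
    exact map_eq_zero_iff _ (IsFractionRing.injective (R ⧸ P) (FractionRing (R ⧸ P)))
  have hsφ : φ s ≠ 0 := fun h => hβ (hscalar β (hs ▸ hD d s ((hφ s).1 h)))
  have hzero : MvPolynomial.aeval ![φ r, φ s] f = 0 := by
    have h := DFunLike.congr_fun (MvPolynomial.comp_aeval ![r, s] φ) f
    rw [AlgHom.comp_apply, hfrs, map_zero] at h
    rw [h]
    congr 2
    ext i
    fin_cases i <;> rfl
  obtain ⟨c, hc⟩ := hfhom.exists_eq_algebraMap_mul_of_aeval_eq_zero hf0 hsφ hzero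
  have hmem : r - c • s ∈ P := by
    rw [← hφ, map_sub, map_smul, hc, Algebra.smul_def, sub_self]
  have hαc : α = c * β := by
    have h := hD d _ hmem
    rw [map_sub, map_smul, hr, hs, Algebra.smul_def, ← map_mul, ← map_sub] at h
    exact sub_eq_zero.1 (hscalar _ h)
  have hβα : β⁻¹ = α⁻¹ * c := by
    field_simp
    rw [hαc, mul_comm]
  rw [hβα, mul_smul, ← smul_sub, Algebra.smul_def]
  exact P.mul_mem_left _ hmem
end
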